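/- arXiv:2203.02617 — 4 statements merged into one kernel-verified Lean document; each statement's English description precedes it below -/
import Mathlib

section
/- (TC Degeneracy) Let A : Fin I₁ → Matrix (Fin R₁) (Fin R₂) ℝ, B : Fin I₂ → Matrix (Fin R₂) (Fin R₃) ℝ, C : Fin I₃ → Matrix (Fin R₃) (Fin R₁) ℝ be the cores of an order-3 TC representation with R₂ ≥ 2, and assume the represented tensor Y, Y i j k = Matrix.trace (A i * B j * C k), is not identically zero. Then there exists a sequence of core families (Aₘ, Bₘ, Cₘ), m : ℕ, with the same dimensions and bond dimensions, such that for every m the sequence represents the same tensor, i.e., Matrix.trace (Aₘ i * Bₘ j * Cₘ k) = Y i j k for all i, j, k, and the TC intensities diverge: ‖Aₘ‖_F * ‖Bₘ‖_F * ‖Cₘ‖_F → ∞ as m → ∞. -/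
open scoped BigOperators
open Filter

/-- Frobenius norm of a core family (an order-3 tensor given by a family of
matrix slices). -/
noncomputable def coreFrobNorm {I R S : ℕ}
    (A : Fin I → Matrix (Fin R) (Fin S) ℝ) : ℝ :=
  Real.sqrt (∑ i, ∑ r, ∑ s, (A i r s) ^ 2)

theorem abs_entry_le_coreFrobNorm {I R S : ℕ} (A : Fin I → Matrix (Fin R) (Fin S) ℝ)
    (i : Fin I) (r : Fin R) (s : Fin S) : |A i r s| ≤ coreFrobNorm A := by
  refine Real.abs_le_sqrt ?_
  calc (A i r s) ^ 2 ≤ ∑ s, (A i r s) ^ 2 :=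
        Finset.single_le_sum (f := fun s => (A i r s) ^ 2)
          (fun _ _ => sq_nonneg _) (Finset.mem_univ s)
    _ ≤ ∑ r, ∑ s, (A i r s) ^ 2 :=
        Finset.single_le_sum (f := fun r => ∑ s, (A i r s) ^ 2)
          (fun _ _ => by positivity) (Finset.mem_univ r)
    _ ≤ ∑ i, ∑ r, ∑ s, (A i r s) ^ 2 :=
        Finset.single_le_sum (f := fun i => ∑ r, ∑ s, (A i r s) ^ 2)
          (fun _ _ => by positivity) (Finset.mem_univ i)

theorem exists_entries_ne_zero_of_trace_ne_zero {R S T : ℕ} {M : Matrix (Fin R) (Fin S) ℝ}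
    {N : Matrix (Fin S) (Fin T) ℝ} {P : Matrix (Fin T) (Fin R) ℝ}
    (h : Matrix.trace (M * N * P) ≠ 0) :
    ∃ r p t, M r p ≠ 0 ∧ N p t ≠ 0 ∧ P t r ≠ 0 := by
  contrapose! h
  simp only [Matrix.trace, Matrix.diag, Matrix.mul_apply, Finset.sum_mul]
  refine Finset.sum_eq_zero fun r _ => Finset.sum_eq_zero fun t _ =>
    Finset.sum_eq_zero fun p _ => ?_
  by_cases hM : M r p = 0
  · simp [hM]
  by_cases hN : N p t = 0
  · simp [hN]
  simp [h r p t hM hN]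

/-- Left multiplication by transvections keeps the norm of a nonzero core family bounded away from
zero, uniformly in the transvection parameter. -/
theorem exists_le_coreFrobNorm_transvection_mul {I R S : ℕ} (B : Fin I → Matrix (Fin R) (Fin S) ℝ)
    {j : Fin I} {p q : Fin R} {t : Fin S} (hpq : p ≠ q) (hB : B j p t ≠ 0) :
    ∃ β > 0, ∀ c : ℝ, β ≤ coreFrobNorm fun j => Matrix.transvection p q c * B j := by
  by_cases hq : B j q t = 0
  · refine ⟨|B j p t|, abs_pos.2 hB, fun c => ?_⟩
    simpa [Matrix.transvection_mul_apply_same, hq] using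
      abs_entry_le_coreFrobNorm (fun j => Matrix.transvection p q c * B j) j p t
  · refine ⟨|B j q t|, abs_pos.2 hq, fun c => ?_⟩
    simpa [Matrix.transvection_mul_apply_of_ne _ _ _ _ hpq.symm] using
      abs_entry_le_coreFrobNorm (fun j => Matrix.transvection p q c * B j) j q t

/-- (TC degeneracy) For any order-3 tensor-chain representation with middle
bond dimension at least 2 representing a nonzero tensor, there is a sequence of
equivalent representations whose TC intensities diverge. -/
theorem tc_degeneracy
    {I₁ I₂ I₃ R₁ R₂ R₃ : ℕ} (hR₂ : 2 ≤ R₂)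
    (A : Fin I₁ → Matrix (Fin R₁) (Fin R₂) ℝ)
    (B : Fin I₂ → Matrix (Fin R₂) (Fin R₃) ℝ)
    (C : Fin I₃ → Matrix (Fin R₃) (Fin R₁) ℝ)
    (Y : Fin I₁ → Fin I₂ → Fin I₃ → ℝ)
    (hY : ∀ i j k, Y i j k = Matrix.trace (A i * B j * C k))
    (hY0 : ∃ i j k, Y i j k ≠ 0) :
    ∃ (A' : ℕ → Fin I₁ → Matrix (Fin R₁) (Fin R₂) ℝ)
      (B' : ℕ → Fin I₂ → Matrix (Fin R₂) (Fin R₃) ℝ)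
      (C' : ℕ → Fin I₃ → Matrix (Fin R₃) (Fin R₁) ℝ),
      (∀ m i j k, Matrix.trace (A' m i * B' m j * C' m k) = Y i j k) ∧
      Tendsto (fun m => coreFrobNorm (A' m) * coreFrobNorm (B' m) *
        coreFrobNorm (C' m)) atTop atTop := by
  obtain ⟨i, j, k, h⟩ := hY0
  rw [hY] at h
  obtain ⟨r, p, t, hA, hB, hC⟩ := exists_entries_ne_zero_of_trace_ne_zero h
  have : Nontrivial (Fin R₂) := Fin.nontrivial_iff_two_le.2 hR₂
  obtain ⟨q, hqp⟩ := exists_ne p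
  obtain ⟨β, hβ, hBβ⟩ := exists_le_coreFrobNorm_transvection_mul B hqp.symm hB
  refine ⟨fun m i => A i * Matrix.transvection p q (m : ℝ),
    fun m j => Matrix.transvection p q (-(m : ℝ)) * B j, fun _ => C, fun m i j k => ?_, ?_⟩
  · have hG : A i * Matrix.transvection p q (m : ℝ) *
        (Matrix.transvection p q (-(m : ℝ)) * B j) = A i * B j := by
      rw [Matrix.mul_assoc, ← Matrix.mul_assoc (Matrix.transvection p q (m : ℝ)),
        Matrix.transvection_mul_transvection_same _ _ hqp.symm, add_neg_cancel,
        Matrix.transvection_zero, Matrix.one_mul]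
    rw [hG, hY]
  · have hγ : 0 < coreFrobNorm C := (abs_pos.2 hC).trans_le (abs_entry_le_coreFrobNorm C k t r)
    have hAlim : Tendsto (fun m : ℕ => coreFrobNorm fun i =>
        A i * Matrix.transvection p q (m : ℝ)) atTop atTop := by
      have hlin : Tendsto (fun m : ℕ => (m : ℝ) * |A i r p| - |A i r q|) atTop atTop :=
        tendsto_atTop_add_const_right _ _
          (tendsto_natCast_atTop_atTop.atTop_mul_const (abs_pos.2 hA))
      refine tendsto_atTop_mono (fun m => ?_) hlin
      have hentry := abs_entry_le_coreFrobNorm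
        (fun i => A i * Matrix.transvection p q (m : ℝ)) i r q
      rw [Matrix.mul_transvection_apply_same] at hentry
      have htri := abs_sub_abs_le_abs_sub ((m : ℝ) * A i r p) (-A i r q)
      rw [abs_mul, Nat.abs_cast, abs_neg, sub_neg_eq_add, add_comm (_ * _)] at htri
      exact htri.trans hentry
    refine Tendsto.atTop_mul_const hγ
      (tendsto_atTop_mono (fun m => ?_) (hAlim.atTop_mul_const hβ))
    exact mul_le_mul_of_nonneg_left (hBβ _) (Real.sqrt_nonneg _)
end

section
/- Let s₁, s₂ : ℝ and for x : ℝ with x² ≠ 1 let Q = ![![1, x], ![x, 1]] : Matrix (Fin 2) (Fin 2) ℝ and S = Matrix.diagonal ![s₁, s₂]. Then Q is invertible and the product of Frobenius norms satisfies ‖Q‖_F * ‖Q⁻¹ * S‖_F = (1 + x²) * sqrt (2 * (s₁² + s₂²)) / |1 - x²|. Consequently, if (s₁, s₂) ≠ (0, 0), this quantity tends to infinity as x → 1 from within (0, 1). -/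
open scoped BigOperators
open Filter

/-- Frobenius norm of a real matrix. -/
noncomputable def matFrobNorm {n m : ℕ} (M : Matrix (Fin n) (Fin m) ℝ) : ℝ :=
  Real.sqrt (∑ i, ∑ j, (M i j) ^ 2)

/-- The rotation matrix `Q = ![![1, x], ![x, 1]]`. -/
noncomputable def rotQ (x : ℝ) : Matrix (Fin 2) (Fin 2) ℝ :=
  !![1, x; x, 1]

theorem det_rotQ (x : ℝ) : (rotQ x).det = 1 - x ^ 2 := by
  rw [rotQ, Matrix.det_fin_two_of]
  ring

theorem matFrobNorm_rotQ (x : ℝ) : matFrobNorm (rotQ x) = Real.sqrt (2 * (1 + x ^ 2)) := by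
  rw [matFrobNorm]
  congr 1
  simp only [Fin.sum_univ_two, rotQ, Matrix.of_apply, Matrix.cons_val_zero, Matrix.cons_val_one]
  ring

theorem matFrobNorm_rotQ_inv_mul_diagonal (s₁ s₂ x : ℝ) :
    matFrobNorm ((rotQ x)⁻¹ * Matrix.diagonal ![s₁, s₂]) =
      Real.sqrt ((1 + x ^ 2) * (s₁ ^ 2 + s₂ ^ 2)) / |1 - x ^ 2| := by
  rw [← Real.sqrt_sq_eq_abs, ← Real.sqrt_div' _ (sq_nonneg _), matFrobNorm]
  congr 1
  rw [Matrix.inv_def, det_rotQ, Ring.inverse_eq_inv']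
  simp only [Fin.sum_univ_two, rotQ, Matrix.mul_diagonal, Matrix.smul_apply,
    Matrix.adjugate_fin_two_of, Matrix.of_apply, Matrix.cons_val_zero, Matrix.cons_val_one,
    smul_eq_mul, div_eq_mul_inv, ← inv_pow]
  ring

theorem matFrobNorm_rotQ_mul (s₁ s₂ x : ℝ) :
    matFrobNorm (rotQ x) * matFrobNorm ((rotQ x)⁻¹ * Matrix.diagonal ![s₁, s₂]) =
      (1 + x ^ 2) * Real.sqrt (2 * (s₁ ^ 2 + s₂ ^ 2)) / |1 - x ^ 2| := by
  have h : (0 : ℝ) ≤ 1 + x ^ 2 := by positivity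
  rw [matFrobNorm_rotQ, matFrobNorm_rotQ_inv_mul_diagonal, ← mul_div_assoc,
    ← Real.sqrt_mul (by positivity),
    show 2 * (1 + x ^ 2) * ((1 + x ^ 2) * (s₁ ^ 2 + s₂ ^ 2)) =
      (1 + x ^ 2) ^ 2 * (2 * (s₁ ^ 2 + s₂ ^ 2)) by ring,
    Real.sqrt_mul (sq_nonneg _), Real.sqrt_sq h]

theorem tendsto_one_add_sq_mul_div_abs_one_sub_sq {c : ℝ} (hc : 0 < c) :
    Tendsto (fun x : ℝ => (1 + x ^ 2) * c / |1 - x ^ 2|)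
      (nhdsWithin 1 (Set.Ioo 0 1)) atTop := by
  have hnum : Tendsto (fun x : ℝ => (1 + x ^ 2) * c) (nhdsWithin 1 (Set.Ioo 0 1))
      (nhds ((1 + 1 ^ 2) * c)) :=
    (Continuous.tendsto (by fun_prop) 1).mono_left nhdsWithin_le_nhds
  have hden : Tendsto (fun x : ℝ => |1 - x ^ 2|) (nhdsWithin 1 (Set.Ioo 0 1))
      (nhdsWithin 0 (Set.Ioi 0)) := by
    refine tendsto_nhdsWithin_iff.2 ⟨?_, ?_⟩
    · have h : Continuous fun x : ℝ => |1 - x ^ 2| := by fun_prop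
      simpa using (h.tendsto 1).mono_left (nhdsWithin_le_nhds (s := Set.Ioo 0 1))
    · filter_upwards [self_mem_nhdsWithin] with x hx
      have : x ^ 2 < 1 := by nlinarith [hx.1, hx.2]
      exact abs_pos.2 (sub_pos.2 this).ne'
  simp only [div_eq_mul_inv]
  exact hnum.pos_mul_atTop (by positivity) hden.inv_tendsto_nhdsGT_zero

/-- For `x² ≠ 1`, the matrix `Q = ![![1,x],![x,1]]` is invertible and
`‖Q‖_F * ‖Q⁻¹ * S‖_F = (1 + x²) √(2(s₁² + s₂²)) / |1 - x²|`, where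
`S = diagonal ![s₁, s₂]`; consequently, if `(s₁, s₂) ≠ (0, 0)` this quantity
diverges as `x → 1` from within `(0, 1)`. -/
theorem rotQ_frobenius_product (s₁ s₂ : ℝ) :
    (∀ x : ℝ, x ^ 2 ≠ 1 →
      IsUnit (rotQ x) ∧
      matFrobNorm (rotQ x) * matFrobNorm ((rotQ x)⁻¹ * Matrix.diagonal ![s₁, s₂]) =
        (1 + x ^ 2) * Real.sqrt (2 * (s₁ ^ 2 + s₂ ^ 2)) / |1 - x ^ 2|) ∧
    ((s₁, s₂) ≠ (0, 0) →
      Tendsto (fun x : ℝ =>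
          matFrobNorm (rotQ x) * matFrobNorm ((rotQ x)⁻¹ * Matrix.diagonal ![s₁, s₂]))
        (nhdsWithin 1 (Set.Ioo 0 1)) atTop) := by
  refine ⟨fun x hx => ⟨?_, matFrobNorm_rotQ_mul s₁ s₂ x⟩, fun hs => ?_⟩
  · rw [Matrix.isUnit_iff_isUnit_det, det_rotQ, isUnit_iff_ne_zero]
    exact sub_ne_zero.2 hx.symm
  · simp only [matFrobNorm_rotQ_mul]
    refine tendsto_one_add_sq_mul_div_abs_one_sub_sq (Real.sqrt_pos.2 ?_)
    rcases not_and_or.1 (fun h => hs (Prod.mk.injEq .. ▸ h)) with h | h <;> positivity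
end

section
/- (Balanced norm for minimal sensitivity) Let N ≥ 1 and let β : Fin N → ℝ with βₙ > 0 for all n, and set β̄ = (∏ₙ βₙ)^(1/N). Then for every α : Fin N → ℝ with αₙ > 0 for all n and ∏ₙ αₙ = 1, one has ∑ₙ (βₙ / αₙ)² ≥ N * β̄², and equality holds if and only if αₙ = βₙ / β̄ for every n. In particular, among all rescalings (α₁ • A₁, …, α_N • A_N) of the cores of a TC model with ∏ αₙ = 1, the sensitivity ∑ₙ (βₙ/αₙ)² (where βₙ = sqrt(Iₙ) * ‖A₋ₙ‖_F) is minimized precisely by the balanced choice αₙ = βₙ / β̄, and the minimal value is N β̄². -/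
open scoped BigOperators

/-- (Balanced norm for minimal sensitivity) For positive reals `β n` with
geometric mean `β̄` and any positive `α n` with `∏ α n = 1`, the sensitivity
`∑ (β n / α n)²` is at least `N β̄²`, with equality iff `α n = β n / β̄` for all
`n`. -/
theorem balanced_norm_minimal_sensitivity
    (N : ℕ) (hN : 1 ≤ N) (β : Fin N → ℝ) (hβ : ∀ n, 0 < β n)
    (β' : ℝ) (hβ' : β' = (∏ n, β n) ^ ((1 : ℝ) / N)) :
    ∀ α : Fin N → ℝ, (∀ n, 0 < α n) → (∏ n, α n) = 1 →
      (N : ℝ) * β' ^ 2 ≤ ∑ n, (β n / α n) ^ 2 ∧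
      ((∑ n, (β n / α n) ^ 2 = (N : ℝ) * β' ^ 2) ↔ ∀ n, α n = β n / β') := by
  intro α hα hprod
  have hN0 : (0 : ℝ) < N := by exact_mod_cast hN
  have hβ'0 : 0 < β' := hβ' ▸ Real.rpow_pos_of_pos (Finset.prod_pos fun n _ => hβ n) _
  have hw : ∀ n ∈ (Finset.univ : Finset (Fin N)), (0 : ℝ) < 1 / N := fun _ _ => by positivity
  have hw1 : ∑ _n : Fin N, (1 : ℝ) / N = 1 := by
    simp [hN0.ne']
  have hz : ∀ n ∈ (Finset.univ : Finset (Fin N)), 0 ≤ (β n / α n) ^ 2 :=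
    fun _ _ => sq_nonneg _
  have hgeom : ∏ n, ((β n / α n) ^ 2) ^ ((1 : ℝ) / N) = β' ^ 2 := by
    rw [Real.finsetProd_rpow _ _ hz, Finset.prod_pow, Finset.prod_div_distrib, hprod, div_one,
      hβ', sq, sq, Real.mul_rpow] <;> exact Finset.prod_nonneg fun n _ => (hβ n).le
  have hsum : ∑ n, (1 : ℝ) / N * (β n / α n) ^ 2 = (∑ n, (β n / α n) ^ 2) / N := by
    rw [← Finset.mul_sum, one_div_mul_eq_div]
  have hle := Real.geom_mean_le_arith_mean_weighted Finset.univ _ _ (fun n hn => (hw n hn).le)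
    hw1 hz
  have heq := Real.geom_mean_eq_arith_mean_weighted_iff_of_pos' Finset.univ _ _ hw hw1 hz
  rw [hgeom, hsum] at hle heq
  refine ⟨by rwa [le_div_iff₀' hN0] at hle, fun h => ?_, fun h => ?_⟩
  · have hmean : (∑ n, (β n / α n) ^ 2) / N = β' ^ 2 := by
      rw [h, mul_div_cancel_left₀ _ hN0.ne']
    intro n
    have hn := heq.mp hmean.symm n (Finset.mem_univ n)
    rw [hmean, sq_eq_sq₀ (div_pos (hβ n) (hα n)).le hβ'0.le] at hn
    rw [← hn, div_div_cancel₀ (hβ n).ne']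
  · simp [h, div_div_cancel₀ (hβ _).ne']
end

section
/- Let m ≥ 1 and let R : Fin (m+1) → ℕ+ with R 0 = R m (bond dimensions) and I : Fin m → ℕ+ (mode dimensions). For each t, let G t : Fin (I t) → Matrix (Fin (R t)) (Fin (R (t+1))) ℝ be a core family. Then the squared Frobenius norm of the train contraction is bounded by the product of the squared Frobenius norms of the cores: ∑_{i₁, …, i_m} ‖G 1 i₁ * G 2 i₂ * ⋯ * G m i_m‖_F² ≤ ∏_{t=1}^{m} ( ∑_{i_t} ‖G t i_t‖_F² ). -/
open scoped BigOperators

/-- Squared Frobenius norm of a real matrix. -/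
def matFrobSq {n m : Type*} [Fintype n] [Fintype m]
    (M : Matrix n m ℝ) : ℝ :=
  ∑ i, ∑ j, (M i j) ^ 2

/-- The partial train contraction of the core families `G t`, at a fixed
multi-index `idx`: the matrix product `G 0 (idx 0) * ⋯ * G (t-1) (idx (t-1))`. -/
noncomputable def trainProd {m : ℕ} (R : Fin (m + 1) → ℕ+) (I : Fin m → ℕ+)
    (G : (t : Fin m) → Fin (I t) → Matrix (Fin (R t.castSucc)) (Fin (R t.succ)) ℝ)
    (idx : (t : Fin m) → Fin (I t)) (t : Fin (m + 1)) :
    Matrix (Fin (R 0)) (Fin (R t)) ℝ :=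
  Fin.induction (motive := fun t => Matrix (Fin (R 0)) (Fin (R t)) ℝ)
    (1 : Matrix (Fin (R 0)) (Fin (R 0)) ℝ)
    (fun s M => M * G s (idx s)) t

theorem matFrobSq_nonneg {n m : Type*} [Fintype n] [Fintype m] (M : Matrix n m ℝ) :
    0 ≤ matFrobSq M :=
  Finset.sum_nonneg fun _ _ => Finset.sum_nonneg fun _ _ => sq_nonneg _

/-- The Frobenius norm is submultiplicative. -/
theorem matFrobSq_mul_le {l m n : Type*} [Fintype l] [Fintype m] [Fintype n]
    (A : Matrix l m ℝ) (B : Matrix m n ℝ) :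
    matFrobSq (A * B) ≤ matFrobSq A * matFrobSq B := by
  unfold matFrobSq
  rw [Finset.sum_comm (f := fun i j => B i j ^ 2), Finset.sum_mul_sum]
  exact Finset.sum_le_sum fun i _ => Finset.sum_le_sum fun k _ =>
    Finset.sum_mul_sq_le_sq_mul_sq Finset.univ (A i) (fun j => B j k)

theorem trainProd_succ {m : ℕ} (R : Fin (m + 1) → ℕ+) (I : Fin m → ℕ+)
    (G : (t : Fin m) → Fin (I t) → Matrix (Fin (R t.castSucc)) (Fin (R t.succ)) ℝ)
    (idx : (t : Fin m) → Fin (I t)) (s : Fin m) :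
    trainProd R I G idx s.succ = trainProd R I G idx s.castSucc * G s (idx s) := by
  simp only [trainProd, Fin.induction_succ]

/-- A nonempty partial train contraction, at a fixed multi-index, is bounded by the product of the
squared Frobenius norms of its factors. -/
theorem matFrobSq_trainProd_succ_le {n : ℕ} (R : Fin (n + 2) → ℕ+) (I : Fin (n + 1) → ℕ+)
    (G : (t : Fin (n + 1)) → Fin (I t) → Matrix (Fin (R t.castSucc)) (Fin (R t.succ)) ℝ)
    (idx : (t : Fin (n + 1)) → Fin (I t)) (s : Fin (n + 1)) :
    matFrobSq (trainProd R I G idx s.succ) ≤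
      ∏ t ∈ Finset.Iic s, matFrobSq (G t (idx t)) := by
  induction s using Fin.induction with
  | zero =>
    have h : Finset.Iic (0 : Fin (n + 1)) = {0} := by ext; simp
    rw [h, Finset.prod_singleton, trainProd_succ]
    exact (congrArg matFrobSq (Matrix.one_mul (G 0 (idx 0)))).le
  | succ s ih =>
    have h : Finset.Iic s.succ = insert s.succ (Finset.Iic s.castSucc) := by
      ext t
      simp only [Finset.mem_Iic, Finset.mem_insert, Fin.le_def, Fin.ext_iff, Fin.val_succ,
        Fin.val_castSucc]
      omega
    have hs : s.succ ∉ Finset.Iic s.castSucc := by simp [Fin.le_def]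
    rw [h, Finset.prod_insert hs, mul_comm, trainProd_succ]
    exact (matFrobSq_mul_le _ _).trans (mul_le_mul_of_nonneg_right ih (matFrobSq_nonneg _))

/-- The squared Frobenius norm of the train contraction of core families is
bounded by the product of the squared Frobenius norms of the cores. -/
theorem train_contraction_frobSq_le
    (m : ℕ) (hm : 1 ≤ m)
    (R : Fin (m + 1) → ℕ+) (hR : R 0 = R (Fin.last m))
    (I : Fin m → ℕ+)
    (G : (t : Fin m) → Fin (I t) → Matrix (Fin (R t.castSucc)) (Fin (R t.succ)) ℝ) :
    ∑ idx : (t : Fin m) → Fin (I t),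
        matFrobSq (trainProd R I G idx (Fin.last m)) ≤
      ∏ t : Fin m, ∑ i : Fin (I t), matFrobSq (G t i) := by
  obtain ⟨n, rfl⟩ := Nat.exists_eq_add_of_le' hm
  rw [Fintype.prod_sum]
  refine Finset.sum_le_sum fun idx _ => ?_
  have h : Finset.Iic (Fin.last n) = Finset.univ := by ext t; simp [Fin.le_last]
  have := matFrobSq_trainProd_succ_le R I G idx (Fin.last n)
  rwa [h] at this
end
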